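/- Let R be an associative ring with 1 in which n·1 is invertible, and suppose R is Lie nilpotent of index k. Then for every n×n matrix A over R one has A·radj_{(k)}(A) = n·A·P₁⋯P_k = rdet_{(k)}(A)·Iₙ, where Iₙ is the identity matrix. -/

import Mathlib

/-- `lnc a [x₁,…,x_m]` is the left-normed commutator `[…[[a,x₁],x₂],…,x_m]`,
where `[a,b] = a*b - b*a`. -/
def lnc {R : Type*} [Ring R] : R → List R → R
  | a, [] => a
  | a, x :: l => lnc (a * x - x * a) l

/-- `LNC k x` is the left-normed commutator `[x 0, x 1, …, x k]` of the `k+1`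
elements `x 0, …, x k`. -/
def LNC {R : Type*} [Ring R] (k : ℕ) (x : ℕ → R) : R :=
  lnc (x 0) ((List.range k).map fun i => x (i + 1))

/-- A ring `R` is Lie nilpotent of index `k` if all left-normed commutators of
any `k+1` of its elements vanish. -/
def LieNilpotentOfIndex (R : Type*) [Ring R] (k : ℕ) : Prop :=
  ∀ x : ℕ → R, LNC k x = 0

/-- The symmetric determinant. -/
def sdet {R : Type*} [Ring R] {n : ℕ} (A : Matrix (Fin n) (Fin n) R) : R :=
  ∑ α : Equiv.Perm (Fin n), ∑ β : Equiv.Perm (Fin n),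
    ((Equiv.Perm.sign α * Equiv.Perm.sign β : ℤˣ) : ℤ) •
      (List.ofFn fun i => A (α i) (β i)).prod

/-- The symmetric adjoint. -/
def sadj {R : Type*} [Ring R] {n : ℕ} (A : Matrix (Fin (n + 1)) (Fin (n + 1)) R) :
    Matrix (Fin (n + 1)) (Fin (n + 1)) R :=
  fun r s => (-1 : R) ^ ((r : ℕ) + (s : ℕ)) * sdet (A.submatrix s.succAbove r.succAbove)

/-- `adjAux A j = (P_j, P₁ * ⋯ * P_j)` where `(P_j)` is the right adjoint sequence of `A`. -/
def adjAux {R : Type*} [Ring R] {n : ℕ} (A : Matrix (Fin (n + 1)) (Fin (n + 1)) R) :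
    ℕ → Matrix (Fin (n + 1)) (Fin (n + 1)) R × Matrix (Fin (n + 1)) (Fin (n + 1)) R
  | 0 => (1, 1)
  | j + 1 =>
      let q := adjAux A j
      let p := sadj (A * q.2)
      (p, q.2 * p)

/-- The product `P₁ * ⋯ * P_k` of the right adjoint sequence of `A`. -/
def radjProd {R : Type*} [Ring R] {n : ℕ} (A : Matrix (Fin (n + 1)) (Fin (n + 1)) R)
    (k : ℕ) : Matrix (Fin (n + 1)) (Fin (n + 1)) R :=
  (adjAux A k).2

/-- The `k`-th right adjoint `radj_{(k)}(A) = n • (P₁ * ⋯ * P_k)`. -/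
def radj {R : Type*} [Ring R] {n : ℕ} (A : Matrix (Fin (n + 1)) (Fin (n + 1)) R)
    (k : ℕ) : Matrix (Fin (n + 1)) (Fin (n + 1)) R :=
  (n + 1) • radjProd A k

/-- The `k`-th right determinant `rdet_{(k)}(A) = tr (A * P₁ * ⋯ * P_k)`. -/
def rdet {R : Type*} [Ring R] {n : ℕ} (A : Matrix (Fin (n + 1)) (Fin (n + 1)) R)
    (k : ℕ) : R :=
  (A * radjProd A k).trace

/-- The `k`-th right characteristic polynomial `p_{A,k}(x) = rdet_{(k)}(x Iₙ - A)`. -/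
noncomputable def rcharpoly {R : Type*} [Ring R] {n : ℕ}
    (A : Matrix (Fin (n + 1)) (Fin (n + 1)) R) (k : ℕ) : Polynomial R :=
  rdet ((Polynomial.X : Polynomial R) • (1 : Matrix (Fin (n + 1)) (Fin (n + 1)) (Polynomial R))
    - A.map Polynomial.C) k

/-- The `i`-th term of the upper Lie central series of `R`: the elements `c` such that
`[c, y₁, …, y_i] = 0` for all `y₁, …, y_i`. -/
def upperLieCentral (R : Type*) [Ring R] : ℕ → AddSubgroup R
  | 0 => ⊥
  | i + 1 =>
    { carrier := {c | ∀ y, ⁅c, y⁆ ∈ upperLieCentral R i}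
      zero_mem' := fun y => by simp [Ring.lie_def]
      add_mem' := fun {a b} ha hb y => by
        have h : ⁅a + b, y⁆ = ⁅a, y⁆ + ⁅b, y⁆ := by
          simp only [Ring.lie_def]
          noncomm_ring
        rw [h]
        exact add_mem (ha y) (hb y)
      neg_mem' := fun {a} ha y => by
        have h : ⁅-a, y⁆ = -⁅a, y⁆ := by
          simp only [Ring.lie_def]
          noncomm_ring
        rw [h]
        exact neg_mem (ha y) }

namespace upperLieCentral

variable {R : Type*} [Ring R] {i : ℕ}

theorem mem_zero {c : R} : c ∈ upperLieCentral R 0 ↔ c = 0 := Iff.rfl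

theorem mem_succ {c : R} :
    c ∈ upperLieCentral R (i + 1) ↔ ∀ y, ⁅c, y⁆ ∈ upperLieCentral R i := Iff.rfl

theorem le_succ (i : ℕ) : upperLieCentral R i ≤ upperLieCentral R (i + 1) := by
  induction i with
  | zero =>
    intro c hc y
    rw [mem_zero.1 hc, Ring.lie_def, zero_mul, mul_zero, sub_zero]
    exact zero_mem _
  | succ i ih => exact fun c hc y => ih (hc y)

theorem lie_mem {c : R} (hc : c ∈ upperLieCentral R i) (y : R) :
    ⁅c, y⁆ ∈ upperLieCentral R i :=
  le_succ i hc y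

theorem lie_lie_mem {c : R} (hc : c ∈ upperLieCentral R (i + 2)) (x y : R) :
    ⁅c, ⁅x, y⁆⁆ ∈ upperLieCentral R i := by
  have h : ⁅c, ⁅x, y⁆⁆ = ⁅⁅c, x⁆, y⁆ - ⁅⁅c, y⁆, x⁆ := by
    simp only [Ring.lie_def]
    noncomm_ring
  rw [h]
  exact sub_mem (hc x y) (hc y x)

theorem lie_lie_mul_pow (c x y : R) (m : ℕ) :
    ⁅⁅c, x⁆ * x ^ m, y⁆ = ⁅⁅c, y⁆, x⁆ * x ^ m + ⁅c, ⁅x, x ^ m * y⁆⁆ +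
      ∑ a ∈ Finset.range m, ⁅⁅c, ⁅x, x ^ a * y⁆⁆, x⁆ * x ^ (m - 1 - a) := by
  induction m with
  | zero =>
    simp only [Ring.lie_def, Finset.range_zero, Finset.sum_empty]
    noncomm_ring
  | succ m ih =>
    have hsum : ∑ a ∈ Finset.range (m + 1), ⁅⁅c, ⁅x, x ^ a * y⁆⁆, x⁆ * x ^ (m + 1 - 1 - a) =
        (∑ a ∈ Finset.range m, ⁅⁅c, ⁅x, x ^ a * y⁆⁆, x⁆ * x ^ (m - 1 - a)) * x +
          ⁅⁅c, ⁅x, x ^ m * y⁆⁆, x⁆ := by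
      rw [Finset.sum_range_succ, Finset.sum_mul]
      congr 1
      · refine Finset.sum_congr rfl fun a ha => ?_
        have := Finset.mem_range.1 ha
        rw [mul_assoc, ← pow_succ]
        congr 2
        omega
      · simp
    rw [hsum, eq_sub_iff_add_eq'.2 ih.symm]
    have hx : x * x ^ m = x ^ m * x := (pow_succ' x m).symm.trans (pow_succ x m)
    generalize hp : x ^ m = p at *
    simp only [Ring.lie_def, pow_succ, hp, mul_sub, sub_mul, add_mul, ← mul_assoc, hx]
    simp only [mul_assoc, hx]
    abel

theorem lie_mul_pow_mem (i : ℕ) {c : R} (hc : c ∈ upperLieCentral R (i + 1)) (x : R) (m : ℕ) :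
    ⁅c, x⁆ * x ^ m ∈ upperLieCentral R i := by
  induction i generalizing c m with
  | zero =>
    rw [mem_zero.1 (hc x), zero_mul]
    exact zero_mem _
  | succ i ih =>
    intro y
    rw [lie_lie_mul_pow]
    exact add_mem (add_mem (ih (hc y) m) (lie_lie_mem hc _ _))
      (sum_mem fun a _ => ih (le_succ i (lie_lie_mem hc _ _)) _)

open Polynomial in
theorem mem_polynomial {f : R[X]} :
    f ∈ upperLieCentral R[X] i ↔ ∀ m, f.coeff m ∈ upperLieCentral R i := by
  induction i generalizing f with
  | zero => simp [mem_zero, Polynomial.ext_iff]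
  | succ i ih =>
    constructor
    · intro h m y
      have := ih.1 (h (C y)) m
      simpa [Ring.lie_def] using this
    · intro h g
      refine ih.2 fun m => ?_
      rw [Ring.lie_def, coeff_sub, coeff_mul, coeff_mul,
        ← Finset.Nat.sum_antidiagonal_swap (f := fun x : ℕ × ℕ => g.coeff x.1 * f.coeff x.2),
        ← Finset.sum_sub_distrib]
      exact sum_mem fun x _ => by simpa [Ring.lie_def] using h x.1 (g.coeff x.2)

open Polynomial in
theorem lie_mul_pow_mem_of_scalar {lam c : R} (hc : c ∈ upperLieCentral R (i + 1)) (t : ℤ)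
    (m : ℕ) : ⁅c, lam⁆ * (t * lam + c) ^ m ∈ upperLieCentral R i := by
  have hC : (C c : R[X]) ∈ upperLieCentral R[X] (i + 1) := mem_polynomial.2 fun j => by
    rw [coeff_C]
    split_ifs
    · exact hc
    · exact zero_mem _
  have h := lie_mul_pow_mem i hC (X * C lam + C c) m
  have hX : ⁅(C c : R[X]), X * C lam + C c⁆ * (X * C lam + C c) ^ m =
      X * (C ⁅c, lam⁆ * (X * C lam + C c) ^ m) := by
    rw [← mul_assoc]
    congr 1
    simp only [Ring.lie_def, mul_add, add_mul, C_sub, C_mul, mul_sub, ← mul_assoc]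
    rw [X_mul_C c]
    simp only [mul_assoc, X_mul_C]
    abel
  rw [hX] at h
  have h' : ∀ j, (C ⁅c, lam⁆ * (X * C lam + C c) ^ m).coeff j ∈ upperLieCentral R i := fun j => by
    simpa using mem_polynomial.1 h (j + 1)
  let ev : R[X] →+* R := eval₂RingHom' (RingHom.id R) (t : R) fun a => (Int.cast_commute t a).symm
  have hev : ev (C ⁅c, lam⁆ * (X * C lam + C c) ^ m) = ⁅c, lam⁆ * (t * lam + c) ^ m := by
    have hev_X : ev X = t := eval₂_X _ _
    have hev_C : ∀ a, ev (C a) = a := fun a => eval₂_C _ _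
    rw [map_mul, map_pow, map_add, map_mul, hev_X, hev_C, hev_C, hev_C]
  rw [← hev]
  change eval₂ _ _ _ ∈ _
  rw [eval₂_eq_sum_range]
  refine sum_mem fun j _ => ?_
  rw [← Int.cast_pow, ← zsmul_eq_mul']
  exact zsmul_mem (h' j) _

/-- The additive subgroup `ℤ lam + Z`. -/
def intSpanSup (lam : R) (Z : AddSubgroup R) : AddSubgroup R :=
  AddSubgroup.zmultiples lam ⊔ Z

theorem mem_intSpanSup {lam x : R} {Z : AddSubgroup R} :
    x ∈ intSpanSup lam Z ↔ ∃ t : ℤ, ∃ c ∈ Z, t * lam + c = x := by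
  simp [intSpanSup, AddSubgroup.mem_sup, AddSubgroup.mem_zmultiples_iff]

theorem lie_mul_pow_mem_of_mem_intSpanSup {lam x z : R}
    (hx : x ∈ intSpanSup lam (upperLieCentral R (i + 1)))
    (hz : z ∈ intSpanSup lam (upperLieCentral R (i + 1))) (m : ℕ) :
    ⁅x, z⁆ * z ^ m ∈ upperLieCentral R i := by
  obtain ⟨p, d, hd, rfl⟩ := mem_intSpanSup.1 hx
  obtain ⟨t, c, hc, rfl⟩ := mem_intSpanSup.1 hz
  have h : ⁅p * lam + d, t * lam + c⁆ = -(p • ⁅c, lam⁆) + ⁅d, t * lam + c⁆ := by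
    simp only [Ring.lie_def, ← zsmul_eq_mul, mul_add, add_mul, smul_mul_assoc, mul_smul_comm,
      smul_sub, smul_add, smul_comm p t]
    abel
  rw [h, add_mul, neg_mul, smul_mul_assoc]
  exact add_mem (neg_mem (zsmul_mem (lie_mul_pow_mem_of_scalar hc t m) p)) (lie_mul_pow_mem i hd _ m)

theorem pow_mul_mul_pow_sub_mem {lam x z : R}
    (hx : x ∈ intSpanSup lam (upperLieCentral R (i + 1)))
    (hz : z ∈ intSpanSup lam (upperLieCentral R (i + 1))) (l m : ℕ) :
    z ^ l * x * z ^ m - x * z ^ (l + m) ∈ upperLieCentral R i := by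
  have key : ∀ l m, z ^ l * (⁅x, z⁆ * z ^ m) ∈ upperLieCentral R i := by
    intro l
    induction l with
    | zero => simpa using lie_mul_pow_mem_of_mem_intSpanSup hx hz
    | succ l ih =>
      intro m
      have h : z ^ (l + 1) * (⁅x, z⁆ * z ^ m) =
          z ^ l * (⁅x, z⁆ * z ^ (m + 1)) - ⁅z ^ l * (⁅x, z⁆ * z ^ m), z⁆ := by
        rw [Ring.lie_def (z ^ l * _), pow_succ z m, pow_succ' z l]
        noncomm_ring
      rw [h]
      exact sub_mem (ih _) (lie_mem (ih m) z)
  induction l generalizing m with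
  | zero => simp [zero_mem]
  | succ l ih =>
    have h : z ^ (l + 1) * x * z ^ m - x * z ^ (l + 1 + m) =
        z ^ l * x * z ^ (m + 1) - x * z ^ (l + (m + 1)) - z ^ l * (⁅x, z⁆ * z ^ m) := by
      rw [show l + (m + 1) = l + 1 + m by omega, Ring.lie_def, pow_succ' z m, pow_succ z l]
      noncomm_ring
    rw [h]
    exact sub_mem (ih _) (key l m)

theorem mem_of_nsmul_mem {n : ℕ} (hn : IsUnit (n : R)) {c : R}
    (hc : n • c ∈ upperLieCentral R i) : c ∈ upperLieCentral R i := by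
  induction i generalizing c with
  | zero =>
    rw [mem_zero, nsmul_eq_mul] at hc
    exact mem_zero.2 ((hn.mul_right_eq_zero).1 hc)
  | succ i ih =>
    refine fun y => ih ?_
    rw [Ring.lie_def, smul_sub, ← smul_mul_assoc, ← mul_smul_comm]
    exact hc y

theorem mem_of_lnc_eq_zero {k : ℕ} {a : R} (h : ∀ l : List R, l.length = k → lnc a l = 0) :
    a ∈ upperLieCentral R k := by
  induction k generalizing a with
  | zero => exact h [] rfl
  | succ k ih => exact fun y => ih fun l hl => h (y :: l) (by simp [hl])

theorem eq_top_of_lieNilpotentOfIndex {k : ℕ} (h : LieNilpotentOfIndex R k) :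
    upperLieCentral R k = ⊤ := by
  refine eq_top_iff.2 fun a _ => mem_of_lnc_eq_zero fun l hl => ?_
  have := h fun j => (a :: l).getD j 0
  have hl' : (List.range k).map (fun i => (a :: l).getD (i + 1) 0) = l := by
    refine List.ext_getElem (by simp [hl]) fun j h₁ h₂ => ?_
    simp [h₂]
  simpa only [LNC, hl', List.getD_cons_zero] using this

end upperLieCentral

/-- Polarization: if the values of a multilinear map on the diagonal of `S` lie in `Z`, then so do
its symmetrized values on families from `S`. -/
theorem MultilinearMap.sum_perm_mem {R M : Type*} [AddCommGroup R] [AddCommGroup M] {n : ℕ}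
    (φ : MultilinearMap ℤ (fun _ : Fin n => R) M) (S : AddSubgroup R) (Z : AddSubgroup M)
    (h : ∀ z ∈ S, φ (fun _ => z) ∈ Z) (y : Fin n → R) (hy : ∀ j, y j ∈ S) :
    ∑ σ : Equiv.Perm (Fin n), φ (fun i => y (σ i)) ∈ Z := by
  have h₁ := Finset.inclusion_exclusion_sum_inf_compl (Finset.univ : Finset (Fin n))
    (fun j => Fintype.piFinset fun _ : Fin n => ({j}ᶜ : Finset (Fin n)))
    (fun r : Fin n → Fin n => φ fun i => y (r i))
  have h₂ : ∑ σ : Equiv.Perm (Fin n), φ (fun i => y (σ i)) =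
      ∑ r ∈ (Finset.univ : Finset (Fin n)).inf
        (fun j => (Fintype.piFinset fun _ : Fin n => ({j}ᶜ : Finset (Fin n)))ᶜ),
        φ fun i => y (r i) := by
    refine Finset.sum_bij (fun σ _ => ⇑σ) (fun σ _ => ?_) (fun σ _ τ _ h => Equiv.coe_fn_injective h)
      (fun r hr => ?_) fun _ _ => rfl
    · simp only [Finset.mem_inf, Finset.mem_univ, Finset.mem_compl, Fintype.mem_piFinset,
        Finset.mem_singleton, true_implies]
      exact fun j hj => hj (σ.symm j) (σ.apply_symm_apply j)
    · simp only [Finset.mem_inf, Finset.mem_univ, Finset.mem_compl, Fintype.mem_piFinset,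
        Finset.mem_singleton, true_implies, not_forall, not_not] at hr
      exact ⟨Equiv.ofBijective r (Finite.surjective_iff_bijective.1 hr), Finset.mem_univ _, rfl⟩
  rw [h₂, h₁]
  refine sum_mem fun t _ => zsmul_mem ?_ _
  have h₃ : t.inf (fun j => Fintype.piFinset fun _ : Fin n => ({j}ᶜ : Finset (Fin n))) =
      Fintype.piFinset fun _ : Fin n => tᶜ := by
    ext r
    simp only [Finset.mem_inf, Fintype.mem_piFinset, Finset.mem_compl, Finset.mem_singleton]
    exact ⟨fun h i hi => h _ hi i rfl, fun h j hj i hi => h i (hi ▸ hj)⟩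
  rw [h₃, ← φ.map_sum_finset (fun _ j => y j) fun _ => tᶜ]
  exact h _ (sum_mem fun j _ => hy j)

theorem List.prod_ofFn_insertNth_const {R : Type*} [Monoid R] {n : ℕ} (l : Fin (n + 1)) (x z : R) :
    (List.ofFn (l.insertNth x fun _ => z : Fin (n + 1) → R)).prod =
      z ^ (l : ℕ) * x * z ^ (n - l) := by
  induction n with
  | zero =>
    obtain rfl := Fin.fin_one_eq_zero l
    simp
  | succ n ih =>
    refine Fin.cases ?_ (fun l => ?_) l
    · simp [pow_succ']
    · have h : (l.succ.insertNth x (fun _ => z) : Fin (n + 2) → R) =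
          Fin.cons z (l.insertNth x fun _ => z : Fin (n + 1) → R) := by
        refine (Fin.eq_insertNth_iff.2 ⟨by simp, funext fun j => ?_⟩).symm
        refine Fin.cases ?_ (fun j => ?_) j <;> simp [Fin.removeNth]
      rw [h, List.ofFn_succ, List.prod_cons]
      simp only [Fin.cons_zero, Fin.cons_succ]
      rw [ih, Fin.val_succ, pow_succ', Nat.succ_sub_succ, mul_assoc, mul_assoc, mul_assoc]

namespace Equiv.Perm

variable {n : ℕ}

/-- The permutation that maps `l` to `t` and acts on the complements as `σ`. -/
def insertAt (l t : Fin (n + 1)) (σ : Perm (Fin n)) : Perm (Fin (n + 1)) :=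
  t.cycleRange.symm * (decomposeFin.symm (0, σ) * l.cycleRange)

@[simp]
theorem insertAt_self (l t : Fin (n + 1)) (σ : Perm (Fin n)) : insertAt l t σ l = t := by
  simp [insertAt]

@[simp]
theorem insertAt_succAbove (l t : Fin (n + 1)) (σ : Perm (Fin n)) (j : Fin n) :
    insertAt l t σ (l.succAbove j) = t.succAbove (σ j) := by
  simp [insertAt]

theorem sign_insertAt (l t : Fin (n + 1)) (σ : Perm (Fin n)) :
    sign (insertAt l t σ) = (-1) ^ (l : ℕ) * (-1) ^ (t : ℕ) * sign σ := by
  simp [insertAt, decomposeFin.symm_sign]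
  ac_rfl

theorem sum_insertAt_left {M : Type*} [AddCommMonoid M] (t : Fin (n + 1))
    (f : Perm (Fin (n + 1)) → M) : ∑ α, f α = ∑ l, ∑ σ, f (insertAt l t σ) := by
  rw [← Fintype.sum_prod_type' fun l σ => f (insertAt l t σ)]
  refine (Function.Bijective.sum_comp (g := f)
    ((Fintype.bijective_iff_injective_and_card _).2 ⟨?_, ?_⟩)).symm
  · rintro ⟨l, σ⟩ ⟨l', σ'⟩ h
    have hl : l = l' := (insertAt l t σ).injective <| by
      simp only [insertAt_self] at h ⊢
      rw [h, insertAt_self]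
    subst hl
    refine Prod.ext rfl (Equiv.ext fun j => t.succAbove_right_injective ?_)
    simpa using DFunLike.congr_fun h (l.succAbove j)
  · simp [Fintype.card_perm, Nat.factorial_succ]

theorem sum_insertAt_right {M : Type*} [AddCommMonoid M] (l : Fin (n + 1))
    (f : Perm (Fin (n + 1)) → M) : ∑ α, f α = ∑ t, ∑ σ, f (insertAt l t σ) := by
  rw [← Fintype.sum_prod_type' fun t σ => f (insertAt l t σ)]
  refine (Function.Bijective.sum_comp (g := f)
    ((Fintype.bijective_iff_injective_and_card _).2 ⟨?_, ?_⟩)).symm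
  · rintro ⟨t, σ⟩ ⟨t', σ'⟩ h
    have ht : t = t' := by simpa using DFunLike.congr_fun h l
    subst ht
    refine Prod.ext rfl (Equiv.ext fun j => t.succAbove_right_injective ?_)
    simpa using DFunLike.congr_fun h (l.succAbove j)
  · simp [Fintype.card_perm, Nat.factorial_succ]

end Equiv.Perm

section SymmetricDeterminant

variable {R : Type*} [Ring R] {n : ℕ}

open Equiv.Perm

/-- The part of `sdet M` in which the entry from row `s` is the `l`-th factor. -/
def sdetPart (M : Matrix (Fin (n + 1)) (Fin (n + 1)) R) (s l : Fin (n + 1)) : R :=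
  ∑ t : Fin (n + 1), ∑ σ : Equiv.Perm (Fin n), ∑ τ : Equiv.Perm (Fin n),
    (((-1) ^ (t + s : ℕ) * (sign σ * sign τ) : ℤˣ) : ℤ) •
      (List.ofFn (l.insertNth (M s t) fun j => M (s.succAbove (σ j)) (t.succAbove (τ j)) :
        Fin (n + 1) → R)).prod

theorem sdet_eq_sum_sdetPart (M : Matrix (Fin (n + 1)) (Fin (n + 1)) R) (s : Fin (n + 1)) :
    sdet M = ∑ l, sdetPart M s l := by
  have h := sum_insertAt_left s fun α : Equiv.Perm (Fin (n + 1)) => ∑ β : Equiv.Perm (Fin (n + 1)),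
    ((sign α * sign β : ℤˣ) : ℤ) • (List.ofFn fun i => M (α i) (β i)).prod
  rw [sdet, h]
  refine Finset.sum_congr rfl fun l _ => ?_
  refine Eq.trans ?_ Finset.sum_comm
  refine Finset.sum_congr rfl fun σ _ => ?_
  have h := sum_insertAt_right l fun β : Equiv.Perm (Fin (n + 1)) =>
    ((sign (insertAt l s σ) * sign β : ℤˣ) : ℤ) •
      (List.ofFn fun i => M (insertAt l s σ i) (β i)).prod
  rw [h]
  refine Finset.sum_congr rfl fun t _ => Finset.sum_congr rfl fun τ _ => ?_
  congr 2
  · rw [sign_insertAt, sign_insertAt]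
    have h : ((-1 : ℤˣ) ^ (l : ℕ)) * (-1) ^ (l : ℕ) = 1 := Int.units_mul_self _
    rw [pow_add]
    calc _ = ((-1 : ℤˣ) ^ (l : ℕ) * (-1) ^ (l : ℕ)) *
          ((-1) ^ (t : ℕ) * (-1) ^ (s : ℕ) * (sign σ * sign τ)) := by ac_rfl
      _ = _ := by rw [h, one_mul]
  · congr 1
    ext i
    refine Fin.succAboveCases l ?_ (fun j => ?_) i <;> simp

theorem sdetPart_zero (M : Matrix (Fin (n + 1)) (Fin (n + 1)) R) (s : Fin (n + 1)) :
    sdetPart M s 0 = ∑ t, M s t * sadj M t s := by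
  refine Finset.sum_congr rfl fun t _ => ?_
  simp only [sadj, sdet, Finset.mul_sum]
  refine Finset.sum_congr rfl fun σ _ => Finset.sum_congr rfl fun τ _ => ?_
  have h : (((-1) ^ (t + s : ℕ) : ℤˣ) : ℤ) • (1 : R) = (-1) ^ (t + s : ℕ) := by
    rw [zsmul_eq_mul, mul_one]
    push_cast
    rfl
  rw [Units.val_mul, mul_smul, ← h, smul_mul_assoc, one_mul, mul_smul_comm, mul_smul_comm,
    List.ofFn_succ, List.prod_cons]
  simp

theorem sdetPart_sub_mem {i : ℕ} {lam : R} (M : Matrix (Fin (n + 1)) (Fin (n + 1)) R)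
    (hM : ∀ r s, M r s ∈ upperLieCentral.intSpanSup lam (upperLieCentral R (i + 1)))
    (s l : Fin (n + 1)) : sdetPart M s l - sdetPart M s 0 ∈ upperLieCentral R i := by
  simp only [sdetPart, ← Finset.sum_sub_distrib, ← smul_sub]
  refine sum_mem fun t _ => ?_
  let φ : MultilinearMap ℤ (fun _ : Fin n => R) R :=
    (MultilinearMap.mkPiAlgebraFin ℤ (n + 1) R).curryMid l (M s t) -
      (MultilinearMap.mkPiAlgebraFin ℤ (n + 1) R).curryMid 0 (M s t)
  have hφ : ∀ y, φ y = (List.ofFn (l.insertNth (M s t) y : Fin (n + 1) → R)).prod -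
      (List.ofFn ((0 : Fin (n + 1)).insertNth (M s t) y : Fin (n + 1) → R)).prod := fun y => by
    simp [φ]
  have hdiag : ∀ z ∈ upperLieCentral.intSpanSup lam (upperLieCentral R (i + 1)),
      φ (fun _ => z) ∈ upperLieCentral R i := fun z hz => by
    rw [hφ, List.prod_ofFn_insertNth_const, List.prod_ofFn_insertNth_const]
    simpa [Nat.add_sub_cancel' (Nat.lt_succ_iff.1 l.2)] using
      upperLieCentral.pow_mul_mul_pow_sub_mem (hM s t) hz l (n - l)
  have hre : ∀ σ : Equiv.Perm (Fin n), ∑ τ : Equiv.Perm (Fin n),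
      (((-1) ^ (t + s : ℕ) * (sign σ * sign τ) : ℤˣ) : ℤ) •
        φ (fun j => M (s.succAbove (σ j)) (t.succAbove (τ j))) =
      ∑ ρ : Equiv.Perm (Fin n), (((-1) ^ (t + s : ℕ) * sign ρ : ℤˣ) : ℤ) •
        φ (fun j => M (s.succAbove (σ j)) (t.succAbove (ρ (σ j)))) := fun σ => by
    rw [← Equiv.sum_comp (Equiv.mulRight σ)]
    refine Finset.sum_congr rfl fun ρ _ => ?_
    have h : sign σ * sign (ρ * σ) = sign ρ := by
      rw [Equiv.Perm.sign_mul, mul_left_comm, Int.units_mul_self, mul_one]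
    simp only [Equiv.coe_mulRight, h, Equiv.Perm.mul_apply]
  simp only [← hφ, hre]
  rw [Finset.sum_comm]
  refine sum_mem fun ρ _ => ?_
  rw [← Finset.smul_sum]
  exact zsmul_mem (φ.sum_perm_mem _ _ hdiag
    (fun j => M (s.succAbove j) (t.succAbove (ρ j))) fun j => hM _ _) _

theorem sdet_eq_zero_of_row_eq {M : Matrix (Fin n) (Fin n) R} {r s : Fin n} (hrs : r ≠ s)
    (h : M r = M s) : sdet M = 0 := by
  refine Finset.sum_involution (fun α _ => Equiv.swap r s * α) (fun α _ => ?_) (fun α _ _ => ?_)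
    (fun _ _ => Finset.mem_univ _) fun α _ => by simp
  · rw [← Finset.sum_add_distrib]
    refine Finset.sum_eq_zero fun β _ => ?_
    have hM : ∀ j, M (Equiv.swap r s j) = M j := fun j => by
      rw [Equiv.swap_apply_def]
      split_ifs with h₁ h₂
      · rw [h₁, h]
      · rw [h₂, h]
      · rfl
    simp [Equiv.Perm.sign_mul, sign_swap hrs, hM]
  · simpa using hrs

theorem nsmul_sum_mul_sadj_sub_sdet_mem {i : ℕ} {lam : R}
    (M : Matrix (Fin (n + 1)) (Fin (n + 1)) R)
    (hM : ∀ r s, M r s ∈ upperLieCentral.intSpanSup lam (upperLieCentral R (i + 1)))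
    (s : Fin (n + 1)) :
    (n + 1) • (∑ t, M s t * sadj M t s) - sdet M ∈ upperLieCentral R i := by
  have h : (n + 1) • (∑ t, M s t * sadj M t s) - sdet M =
      -∑ l, (sdetPart M s l - sdetPart M s 0) := by
    rw [sdet_eq_sum_sdetPart M s, Finset.sum_sub_distrib, sdetPart_zero]
    simp
  rw [h]
  exact neg_mem (sum_mem fun l _ => sdetPart_sub_mem M hM s l)

theorem nsmul_mul_sadj_sub_mem {i : ℕ} {lam : R} (M : Matrix (Fin (n + 1)) (Fin (n + 1)) R)
    (hM : ∀ r s, M r s ∈ upperLieCentral.intSpanSup lam (upperLieCentral R (i + 1)))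
    (r s : Fin (n + 1)) :
    (n + 1) • (M * sadj M) r s - (if r = s then sdet M else 0) ∈ upperLieCentral R i := by
  rw [Matrix.mul_apply]
  split_ifs with hrs
  · subst hrs
    exact nsmul_sum_mul_sadj_sub_sdet_mem M hM r
  · have h := nsmul_sum_mul_sadj_sub_sdet_mem (M.updateRow s (M r)) (fun a b => by
      by_cases ha : a = s
      · subst ha; simpa using hM r b
      · simpa [ha] using hM a b) s
    have h₀ : sdet (M.updateRow s (M r)) = 0 := sdet_eq_zero_of_row_eq hrs (by simp [hrs])
    have h₁ : ∀ t, sadj (M.updateRow s (M r)) t s = sadj M t s := fun t => by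
      simp [sadj]
    simpa [h₀, h₁] using h

theorem exists_mul_radjProd_sub_mem {k : ℕ} (hn : IsUnit ((n + 1 : ℕ) : R))
    (hL : LieNilpotentOfIndex R k) (A : Matrix (Fin (n + 1)) (Fin (n + 1)) R) {i j : ℕ}
    (hij : i + j = k) :
    ∃ lam : R, ∀ r s,
      (A * radjProd A j) r s - (if r = s then lam else 0) ∈ upperLieCentral R i := by
  induction j generalizing i with
  | zero =>
    obtain rfl : i = k := hij
    exact ⟨0, fun r s => by simp [upperLieCentral.eq_top_of_lieNilpotentOfIndex hL]⟩
  | succ j ih =>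
    obtain ⟨lam, h⟩ := ih (i := i + 1) (by omega)
    obtain ⟨u, hu⟩ := hn.exists_right_inv
    refine ⟨u * sdet (A * radjProd A j), fun r s =>
      upperLieCentral.mem_of_nsmul_mem hn ?_⟩
    have hA : A * radjProd A (j + 1) = A * radjProd A j * sadj (A * radjProd A j) :=
      (Matrix.mul_assoc _ _ _).symm
    have := nsmul_mul_sadj_sub_mem (A * radjProd A j) (i := i) (lam := lam) (fun r s => by
      refine upperLieCentral.mem_intSpanSup.2 ⟨if r = s then 1 else 0, _, h r s, ?_⟩
      split_ifs <;> simp) r s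
    rw [hA, smul_sub, smul_ite, nsmul_eq_mul _ (u * _), ← mul_assoc, hu, one_mul, smul_zero]
    exact this

end SymmetricDeterminant

/-- If `1/n ∈ R` and `R` is Lie nilpotent of index `k`, then for every `n×n` matrix `A`
over `R` (`n ≥ 1`) one has `A · radj_{(k)}(A) = n · A · P₁⋯P_k = rdet_{(k)}(A) · Iₙ`. -/
theorem mul_radj_eq_rdet_smul_one
    (R : Type*) [Ring R] (n k : ℕ) (hn : IsUnit ((n + 1 : ℕ) : R))
    (hL : LieNilpotentOfIndex R k)
    (A : Matrix (Fin (n + 1)) (Fin (n + 1)) R) :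
    A * radj A k = (n + 1) • (A * radjProd A k) ∧
      (n + 1) • (A * radjProd A k) = rdet A k • (1 : Matrix (Fin (n + 1)) (Fin (n + 1)) R) := by
  obtain ⟨lam, h⟩ := exists_mul_radjProd_sub_mem hn hL A (zero_add k)
  have hA : A * radjProd A k = lam • (1 : Matrix (Fin (n + 1)) (Fin (n + 1)) R) := by
    ext r s
    rw [sub_eq_zero.1 (upperLieCentral.mem_zero.1 (h r s))]
    simp [Matrix.one_apply]
  refine ⟨by rw [radj, Matrix.mul_smul], ?_⟩
  rw [rdet, hA, ← smul_assoc]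
  simp [Matrix.trace]
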